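/- Let τ ∈ ℍ and a ∈ ℂ with a ∉ Λ_τ, 2a ∉ Λ_τ. Consider the meromorphic function F(z) := (℘(z) - w)/(℘(z) - ℘(a))^2 on ℂ/Λ_τ, where w := ℘(a) - ℘'(a)^2/℘''(a) and ℘''(a) ≠ 0. Then the residue of F at z = a is zero, and consequently F(z) = c·(℘(z-a) + ℘(z+a) - 2℘(a)) for all z, where c = (℘(a) - w)/℘'(a)^2. -/

import Mathlib

/-- The lattice Λ_τ = ℤ + ℤτ. -/
def lat (τ : ℂ) : Set ℂ := {z | ∃ m n : ℤ, z = m + n * τ}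

/-- The nonzero lattice points of Λ_τ. -/
def latNZ (τ : ℂ) : Set ℂ := {z | (∃ m n : ℤ, z = m + n * τ) ∧ z ≠ 0}

/-- The Weierstrass elliptic function ℘(z|τ). -/
noncomputable def wp (τ z : ℂ) : ℂ :=
  1 / z ^ 2 + ∑' ω : latNZ τ, (1 / (z - (ω : ℂ)) ^ 2 - 1 / (ω : ℂ) ^ 2)

/-- The Weierstrass zeta function ζ(z|τ), with ζ' = -℘. -/
noncomputable def wzeta (τ z : ℂ) : ℂ :=
  1 / z + ∑' ω : latNZ τ, (1 / (z - (ω : ℂ)) + 1 / (ω : ℂ) + z / (ω : ℂ) ^ 2)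

/-- The Weierstrass sigma function σ(z|τ). -/
noncomputable def wsigma (τ z : ℂ) : ℂ :=
  z * ∏' ω : latNZ τ,
    ((1 - z / (ω : ℂ)) * Complex.exp (z / (ω : ℂ) + z ^ 2 / (2 * (ω : ℂ) ^ 2)))

open Filter Topology PeriodPair

lemma tay_aux (L : PeriodPair) (a : ℂ) (ha : a ∉ L.lattice) :
    ∃ (c : ℂ) (F : ℂ → ℂ), AnalyticAt ℂ F 0 ∧ ∀ᶠ t in 𝓝 (0 : ℂ),
      L.weierstrassP (a + t) = L.weierstrassP a + deriv L.weierstrassP a * t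
        + deriv (deriv L.weierstrassP) a / 2 * t ^ 2 + c * t ^ 3 + t ^ 4 * F t := by
  have hA : AnalyticAt ℂ L.weierstrassP (a + 0) := by
    rw [add_zero]; exact L.analyticOnNhd_weierstrassP a ha
  have h : AnalyticAt ℂ (fun t => L.weierstrassP (a + t)) 0 :=
    hA.comp (f := fun t => a + t) (by fun_prop)
  obtain ⟨F, hF, hE⟩ := h.exists_eventuallyEq_sum_add_pow_mul 4
  refine ⟨iteratedDeriv 3 (fun t => L.weierstrassP (a + t)) 0 / 6, F, hF, ?_⟩
  filter_upwards [hE] with t ht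
  rw [ht]
  simp only [Finset.sum_range_succ, Finset.sum_range_zero]
  have e : ∀ n, iteratedDeriv n (fun t => L.weierstrassP (a + t)) 0
      = iteratedDeriv n L.weierstrassP a := by
    intro n; rw [iteratedDeriv_comp_const_add]; simp
  simp only [e, smul_eq_mul]
  rw [iteratedDeriv_zero, iteratedDeriv_one, iteratedDeriv_succ (n := 1), iteratedDeriv_one]
  simp [Nat.factorial]
  ring

/-- the difference of the two sides of the key identity -/
noncomputable def DD (L : PeriodPair) (a z : ℂ) : ℂ :=
  (L.weierstrassP z - L.weierstrassP a) ^ 2 *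
    (L.weierstrassP (z + a) + L.weierstrassP (z - a) - 2 * L.weierstrassP a)
  - deriv (deriv L.weierstrassP) a * (L.weierstrassP z - L.weierstrassP a)
  - deriv L.weierstrassP a ^ 2

lemma P_zero_exp (L : PeriodPair) (z : ℂ) :
    L.weierstrassP z = L.weierstrassPExcept 0 z + 1 / z ^ 2 := by
  have := L.weierstrassPExcept_add 0 z
  simpa using this.symm

lemma near_zero (L : PeriodPair) (a : ℂ) (ha : a ∉ L.lattice) :
    ∃ g : ℂ → ℂ, AnalyticAt ℂ g 0 ∧ ∀ᶠ t in 𝓝 (0 : ℂ), t ≠ 0 → DD L a t = g t := by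
  obtain ⟨c, F, hF, hE⟩ := tay_aux L a ha
  have hE' : ∀ᶠ t in 𝓝 (0 : ℂ), L.weierstrassP (a + -t) = L.weierstrassP a
        + deriv L.weierstrassP a * -t
        + deriv (deriv L.weierstrassP) a / 2 * (-t) ^ 2 + c * (-t) ^ 3 + (-t) ^ 4 * F (-t) := by
    have : Tendsto (fun t : ℂ => -t) (𝓝 0) (𝓝 0) := by
      simpa using (continuous_neg (G := ℂ)).tendsto 0
    exact this.eventually hE
  have hF' : AnalyticAt ℂ (fun t => F (-t)) 0 := by
    have : AnalyticAt ℂ F (-0) := by simpa using hF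
    exact this.comp (f := fun t : ℂ => -t) (by fun_prop)
  have hX := L.analyticAt_weierstrassPExcept 0
  obtain ⟨Fm, hFm⟩ : ∃ Fm : ℂ → ℂ, Fm = fun t => F (-t) := ⟨_, rfl⟩
  rw [← hFm] at hF'
  have hFm' : ∀ t, F (-t) = Fm t := fun t => by rw [hFm]
  simp only [hFm'] at hE'
  set pa := L.weierstrassP a
  set p1 := deriv L.weierstrassP a
  set p2 := deriv (deriv L.weierstrassP) a
  refine ⟨fun t => (2 * (L.weierstrassPExcept 0 t - pa) + t ^ 2 * (L.weierstrassPExcept 0 t - pa) ^ 2)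
      * (p2 + t ^ 2 * (F t + Fm t)) + (F t + Fm t)
      - p2 * (L.weierstrassPExcept 0 t - pa) - p1 ^ 2, by fun_prop, ?_⟩
  filter_upwards [hE, hE'] with t h1 h2 ht
  have h3 : L.weierstrassP (t - a) = L.weierstrassP (a + -t) := by
    rw [← L.weierstrassP_neg]; congr 1; ring
  rw [DD, h3, add_comm t a, h1, h2, P_zero_exp L t]
  field_simp
  ring

lemma near_a (L : PeriodPair) (a : ℂ) (ha : a ∉ L.lattice) (h2a : 2 * a ∉ L.lattice) :
    ∃ R S : ℂ → ℂ, AnalyticAt ℂ R 0 ∧ AnalyticAt ℂ S 0 ∧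
      R 0 = deriv (deriv L.weierstrassP) a / 2 ∧
      (∀ᶠ t in 𝓝 (0 : ℂ), L.weierstrassP (a + t) = L.weierstrassP a
          + t * deriv L.weierstrassP a + t ^ 2 * R t) ∧
      (∀ t : ℂ, t ≠ 0 → t ^ 2 * (L.weierstrassP (a + t + a) + L.weierstrassP (a + t - a)
          - 2 * L.weierstrassP a) = 1 + t ^ 2 * S t) := by
  obtain ⟨c, F, hF, hE⟩ := tay_aux L a ha
  have hX := L.analyticAt_weierstrassPExcept 0
  have hA : AnalyticAt ℂ (fun t => L.weierstrassP (2 * a + t)) 0 := by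
    have : AnalyticAt ℂ L.weierstrassP (2 * a + 0) := by
      rw [add_zero]; exact L.analyticOnNhd_weierstrassP _ h2a
    exact this.comp (f := fun t => 2 * a + t) (by fun_prop)
  refine ⟨fun t => deriv (deriv L.weierstrassP) a / 2 + c * t + t ^ 2 * F t,
    fun t => L.weierstrassP (2 * a + t) + L.weierstrassPExcept 0 t - 2 * L.weierstrassP a,
    by fun_prop, by fun_prop, by simp, ?_, ?_⟩
  · filter_upwards [hE] with t ht
    rw [ht]; ring
  · intro t ht
    have e1 : a + t + a = 2 * a + t := by ring
    have e2 : a + t - a = t := by ring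
    rw [e1, e2, P_zero_exp L t]
    field_simp
    ring

lemma DD_neg (L : PeriodPair) (a z : ℂ) : DD L a (-z) = DD L a z := by
  have e1 : L.weierstrassP (-z + a) = L.weierstrassP (z - a) := by
    rw [← L.weierstrassP_neg]; congr 1; ring
  have e2 : L.weierstrassP (-z - a) = L.weierstrassP (z + a) := by
    rw [← L.weierstrassP_neg]; congr 1; ring
  rw [DD, DD, e1, e2, L.weierstrassP_neg]; ring

lemma DD_add (L : PeriodPair) (a z : ℂ) (l : L.lattice) : DD L a (z + l) = DD L a z := by
  have e1 : z + l + a = z + a + l := by ring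
  have e2 : z + l - a = z - a + l := by ring
  rw [DD, DD, e1, e2]
  simp only [L.weierstrassP_add_coe]

lemma ev_notMem (L : PeriodPair) (b : ℂ) (hb : b ∉ L.lattice) :
    ∀ᶠ t in 𝓝 (0 : ℂ), b + t ∉ L.lattice := by
  have h : Tendsto (fun t : ℂ => b + t) (𝓝 0) (𝓝 b) := by
    have : Continuous (fun t : ℂ => b + t) := by fun_prop
    simpa using this.tendsto 0
  exact h.eventually (L.isClosed_lattice.isOpen_compl.mem_nhds hb)

lemma ev_ne (L : PeriodPair) : ∀ᶠ t in 𝓝 (0 : ℂ), t ≠ 0 → t ∉ L.lattice := by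
  filter_upwards [L.compl_lattice_sdiff_singleton_mem_nhds 0] with t ht h0 hm
  exact ht ⟨hm, h0⟩

open Classical in
/-- the entire extension of DD -/
noncomputable def GG (L : PeriodPair) (a C z : ℂ) : ℂ :=
  if z ∈ L.lattice then C else if z - a ∈ L.lattice ∨ z + a ∈ L.lattice then 0 else DD L a z

lemma GG_add (L : PeriodPair) (a C z : ℂ) (l : L.lattice) : GG L a C (z + l) = GG L a C z := by
  have e1 : z + l + a = z + a + l := by ring
  have e2 : z + l - a = z - a + l := by ring
  have h (y : ℂ) : y + l ∈ L.lattice ↔ y ∈ L.lattice :=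
    L.lattice.toAddSubgroup.add_mem_cancel_right (y := y) l.2
  have i1 := h z
  have i2 := h (z - a)
  have i3 := h (z + a)
  rw [← e2] at i2
  rw [← e1] at i3
  simp only [GG, DD_add]
  split_ifs <;> first | rfl | tauto

lemma GG_neg (L : PeriodPair) (a C z : ℂ) : GG L a C (-z) = GG L a C z := by
  have h1 : -z ∈ L.lattice ↔ z ∈ L.lattice := neg_mem_iff
  have h2 : -z - a ∈ L.lattice ↔ z + a ∈ L.lattice := by
    rw [← neg_mem_iff]; ring_nf
  have h3 : -z + a ∈ L.lattice ↔ z - a ∈ L.lattice := by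
    rw [← neg_mem_iff]; ring_nf
  simp only [GG, DD_neg]
  split_ifs <;> first | rfl | tauto

lemma GG_translate (L : PeriodPair) (a C x y : ℂ) (h : y - x ∈ L.lattice)
    (hx : AnalyticAt ℂ (GG L a C) x) : AnalyticAt ℂ (GG L a C) y := by
  have e : GG L a C = fun z => GG L a C (z - (y - x)) := by
    ext z
    have := GG_add L a C (z - (y - x)) ⟨_, h⟩
    simpa using this
  rw [e]
  have : AnalyticAt ℂ (GG L a C) (y - (y - x)) := by simpa using hx
  exact this.comp (f := fun z => z - (y - x)) (by fun_prop)

lemma key_identity (L : PeriodPair) (a : ℂ) (ha : a ∉ L.lattice) (h2a : 2 * a ∉ L.lattice)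
    (z : ℂ) (hz : z ∉ L.lattice) (hza : z - a ∉ L.lattice) (hza' : z + a ∉ L.lattice) :
    DD L a z = 0 := by
  have hna : -a ∉ L.lattice := by rwa [neg_mem_iff]
  obtain ⟨g, hg, hgE⟩ := near_zero L a ha
  have han0 : AnalyticAt ℂ (GG L a (g 0)) 0 := by
    refine hg.congr ?_
    filter_upwards [hgE, ev_notMem L a ha, ev_notMem L (-a) hna, ev_ne L] with t h1 h2 h3 h4
    by_cases ht : t = 0
    · simp [ht, GG]
    · have e1 : t - a = -a + t := by ring
      have e2 : t + a = a + t := by ring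
      simp [GG, e1, e2, h2, h3, h4 ht, h1 ht]
  have hana : AnalyticAt ℂ (GG L a (g 0)) a := by
    obtain ⟨R, S, hR, hS, hR0, hE1, hE2⟩ := near_a L a ha h2a
    set p1 := deriv L.weierstrassP a with hp1
    set p2 := deriv (deriv L.weierstrassP) a with hp2
    have hH : AnalyticAt ℂ (fun t => (p1 + t * R t) ^ 2 * (1 + t ^ 2 * S t)
        - p2 * (t * p1 + t ^ 2 * R t) - p1 ^ 2) (a - a) := by
      rw [sub_self]; fun_prop
    have hH2 := hH.comp (f := fun z => z - a) (x := a) (by fun_prop)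
    refine hH2.congr ?_
    have hT : Tendsto (fun z : ℂ => z - a) (𝓝 a) (𝓝 0) := by
      have : Continuous (fun t : ℂ => t - a) := by fun_prop
      simpa using this.tendsto a
    have hall := hT.eventually ((hE1.and (ev_notMem L a ha)).and
      ((ev_notMem L (2 * a) h2a).and (ev_ne L)))
    filter_upwards [hall] with y hy
    obtain ⟨⟨h1, h2⟩, h3, h4⟩ := hy
    obtain ⟨t, rfl⟩ : ∃ t, y = a + t := ⟨y - a, by ring⟩
    have e0 : a + t - a = t := by ring
    rw [e0] at h1 h2 h3 h4
    simp only [Function.comp, e0]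
    by_cases ht : t = 0
    · subst ht
      simp [GG, ha]
    · have e2 : a + t + a = 2 * a + t := by ring
      have h5 := hE2 t ht
      rw [GG, if_neg h2, if_neg, DD]
      · rw [h1, ← hp1, ← hp2]
        linear_combination (-(p1 + t * R t) ^ 2) * h5
      · rw [e0, e2]
        exact not_or.mpr ⟨h4 ht, h3⟩
  have hanma : AnalyticAt ℂ (GG L a (g 0)) (-a) := by
    have e : GG L a (g 0) = fun z => GG L a (g 0) (-z) := by
      ext z; rw [GG_neg]
    rw [e]
    have : AnalyticAt ℂ (GG L a (g 0)) (- -a) := by simpa using hana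
    exact this.comp (f := fun z : ℂ => -z) (by fun_prop)
  have hall : ∀ x, AnalyticAt ℂ (GG L a (g 0)) x := by
    intro x
    by_cases h1 : x ∈ L.lattice
    · exact GG_translate L a _ 0 x (by simpa using h1) han0
    by_cases h2 : x - a ∈ L.lattice
    · exact GG_translate L a _ a x h2 hana
    by_cases h3 : x + a ∈ L.lattice
    · exact GG_translate L a _ (-a) x (by simpa using h3) hanma
    have hD : AnalyticAt ℂ (DD L a) x := by
      have q1 := L.analyticOnNhd_weierstrassP _ h1
      have q2 : AnalyticAt ℂ (fun z => L.weierstrassP (z - a)) x :=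
        (L.analyticOnNhd_weierstrassP _ h2).comp (f := fun z => z - a) (by fun_prop)
      have q3 : AnalyticAt ℂ (fun z => L.weierstrassP (z + a)) x :=
        (L.analyticOnNhd_weierstrassP _ h3).comp (f := fun z => z + a) (by fun_prop)
      unfold DD
      fun_prop
    refine hD.congr ?_
    have hT : Tendsto (fun z : ℂ => z - x) (𝓝 x) (𝓝 0) := by
      have : Continuous (fun t : ℂ => t - x) := by fun_prop
      simpa using this.tendsto x
    filter_upwards [hT.eventually (ev_notMem L x h1), hT.eventually (ev_notMem L _ h2),
      hT.eventually (ev_notMem L _ h3)] with y k1 k2 k3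
    have e1 : x + (y - x) = y := by ring
    have e2 : x - a + (y - x) = y - a := by ring
    have e3 : x + a + (y - x) = y + a := by ring
    rw [e1] at k1
    rw [e2] at k2
    rw [e3] at k3
    simp [GG, k1, k2, k3]
  have hdiff : Differentiable ℂ (GG L a (g 0)) := fun x => (hall x).differentiableAt
  have h := hdiff.apply_eq_apply_of_bounded (IsZLattice.isCompact_range_of_periodic L.lattice _
    hdiff.continuous fun z w hw ↦ by
      lift w to L.lattice using hw; exact GG_add _ _ _ _ _).isBounded z a
  simpa [GG, hz, hza, hza', ha] using h

lemma deriv_ne (L : PeriodPair) (a : ℂ) (ha : a ∉ L.lattice) (h2a : 2 * a ∉ L.lattice)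
    (hpp : deriv (deriv L.weierstrassP) a ≠ 0) : deriv L.weierstrassP a ≠ 0 := by
  intro h0
  obtain ⟨R, S, hR, hS, hR0, hE1, hE2⟩ := near_a L a ha h2a
  have hev : ∀ᶠ t in 𝓝[≠] (0 : ℂ),
      R t ^ 2 * (1 + t ^ 2 * S t) = deriv (deriv L.weierstrassP) a * R t := by
    rw [eventually_nhdsWithin_iff]
    filter_upwards [hE1, ev_notMem L a ha, ev_notMem L (2 * a) h2a, ev_ne L] with t h1 h2 h3 h4 ht
    have ht : t ≠ 0 := ht
    have e2 : a + t + a = 2 * a + t := by ring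
    have e0 : a + t - a = t := by ring
    have hk := key_identity L a ha h2a (a + t) h2 (by rw [e0]; exact h4 ht) (by rwa [e2])
    have h5 := hE2 t ht
    rw [DD, h0] at hk
    rw [h0] at h1
    rw [h1] at hk
    have : t ^ 2 ≠ 0 := pow_ne_zero _ ht
    apply mul_left_cancel₀ this
    linear_combination hk - t ^ 2 * R t ^ 2 * h5
  have hRc := hR.continuousAt
  have hSc := hS.continuousAt
  have t1 : Tendsto (fun t => R t ^ 2 * (1 + t ^ 2 * S t)) (𝓝[≠] (0 : ℂ))
      (𝓝 (R 0 ^ 2 * (1 + 0 ^ 2 * S 0))) := by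
    have : ContinuousAt (fun t => R t ^ 2 * (1 + t ^ 2 * S t)) 0 := by fun_prop
    exact this.tendsto.mono_left nhdsWithin_le_nhds
  have t2 : Tendsto (fun t => deriv (deriv L.weierstrassP) a * R t) (𝓝[≠] (0 : ℂ))
      (𝓝 (deriv (deriv L.weierstrassP) a * R 0)) := by
    have : ContinuousAt (fun t => deriv (deriv L.weierstrassP) a * R t) 0 := by fun_prop
    exact this.tendsto.mono_left nhdsWithin_le_nhds
  have := tendsto_nhds_unique (t1.congr' hev) t2
  rw [hR0] at this
  apply hpp
  have h6 : deriv (deriv L.weierstrassP) a ^ 2 = 0 := by linear_combination (-4) * this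
  exact pow_eq_zero_iff (two_ne_zero) |>.mp h6

/-- the period pair (1, τ) -/
def pairOf (τ : ℂ) (hτ : 0 < τ.im) : PeriodPair where
  ω₁ := 1
  ω₂ := τ
  indep := by
    rw [LinearIndependent.pair_iff]
    intro s t h
    have him := congrArg Complex.im h
    have hre := congrArg Complex.re h
    simp at him hre
    have ht : t = 0 := by
      rcases him with h | h
      · exact h
      · exact absurd h hτ.ne'
    subst ht
    simpa using hre

lemma mem_pairOf (τ : ℂ) (hτ : 0 < τ.im) (z : ℂ) : z ∈ (pairOf τ hτ).lattice ↔ z ∈ lat τ := by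
  rw [PeriodPair.mem_lattice]
  simp [pairOf, lat, eq_comm]

lemma wp_eq (τ : ℂ) (hτ : 0 < τ.im) : wp τ = (pairOf τ hτ).weierstrassP := by
  ext z
  set L := pairOf τ hτ with hL
  rw [P_zero_exp L z, wp, add_comm]
  congr 1
  have hs : latNZ τ ⊆ (L.lattice : Set ℂ) := fun x hx => (mem_pairOf τ hτ x).mpr hx.1
  rw [PeriodPair.weierstrassPExcept]
  have h1 := tsum_subtype (latNZ τ) (fun x : ℂ => 1 / (z - x) ^ 2 - 1 / x ^ 2)
  have h2 := tsum_subtype (L.lattice : Set ℂ)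
    (fun x : ℂ => if x = 0 then 0 else 1 / (z - x) ^ 2 - 1 / x ^ 2)
  refine h1.trans (Eq.trans ?_ h2.symm)
  congr 1
  ext x
  have hm := mem_pairOf τ hτ x
  rw [← hL] at hm
  by_cases hx : x ∈ L.lattice
  · by_cases hx0 : x = 0
    · simp [hx0, latNZ]
    · have : x ∈ latNZ τ := ⟨hm.mp hx, hx0⟩
      simp [Set.indicator, this, hx, hx0]
  · have : x ∉ latNZ τ := fun h => hx (hs h)
    simp [Set.indicator, this, hx]

/-- The residue of F(z) = (℘(z)-w)/(℘(z)-℘(a))² at z = a vanishes, and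
F(z) = c(℘(z-a) + ℘(z+a) - 2℘(a)) with c = (℘(a)-w)/℘'(a)². -/
theorem stmt_10 (τ : ℂ) (hτ : 0 < τ.im) (a : ℂ)
    (ha : a ∉ lat τ) (h2a : 2 * a ∉ lat τ)
    (hpp : deriv (deriv (wp τ)) a ≠ 0)
    (w c : ℂ)
    (hw : w = wp τ a - (deriv (wp τ) a) ^ 2 / deriv (deriv (wp τ)) a)
    (hc : c = (wp τ a - w) / (deriv (wp τ) a) ^ 2)
    (F : ℂ → ℂ)
    (hF : ∀ z, F z = (wp τ z - w) / (wp τ z - wp τ a) ^ 2) :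
    Filter.Tendsto (fun z => deriv (fun u => (u - a) ^ 2 * F u) z)
      (nhdsWithin a {a}ᶜ) (nhds 0) ∧
    (∀ z, z ∉ lat τ → z - a ∉ lat τ → z + a ∉ lat τ →
      F z = c * (wp τ (z - a) + wp τ (z + a) - 2 * wp τ a)) := by
  rw [wp_eq τ hτ] at *
  simp only [← mem_pairOf τ hτ] at *
  set L := pairOf τ hτ with hL
  have hp1 := deriv_ne L a ha h2a hpp
  have hmain : ∀ z, z ∉ L.lattice → z - a ∉ L.lattice → z + a ∉ L.lattice →
      F z = c * (L.weierstrassP (z - a) + L.weierstrassP (z + a) - 2 * L.weierstrassP a) := by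
    intro z h1 h2 h3
    have hk := key_identity L a ha h2a z h1 h2 h3
    rw [DD] at hk
    have hne : L.weierstrassP z - L.weierstrassP a ≠ 0 := by
      intro h
      rw [h] at hk
      apply hp1
      have : deriv L.weierstrassP a ^ 2 = 0 := by linear_combination -hk
      exact pow_eq_zero_iff (two_ne_zero) |>.mp this
    rw [hF, hc, hw]
    field_simp
    linear_combination (-deriv L.weierstrassP a ^ 2) * hk
  refine ⟨?_, hmain⟩
  obtain ⟨R, S, hR, hS, hR0, hE1, hE2⟩ := near_a L a ha h2a
  have hT : Tendsto (fun z : ℂ => z - a) (𝓝 a) (𝓝 0) := by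
    have : Continuous (fun t : ℂ => t - a) := by fun_prop
    simpa using this.tendsto a
  have hS' : AnalyticAt ℂ (fun z => S (z - a)) a := by
    have : AnalyticAt ℂ S (a - a) := by simpa using hS
    exact this.comp (f := fun z => z - a) (by fun_prop)
  obtain ⟨T, hTS⟩ : ∃ T : ℂ → ℂ, T = fun z => S (z - a) := ⟨_, rfl⟩
  rw [← hTS] at hS'
  have hTS' : ∀ z, T z = S (z - a) := fun z => by rw [hTS]
  set H : ℂ → ℂ := fun z => c * (1 + (z - a) ^ 2 * T z) with hH
  have hHan : AnalyticAt ℂ H a := by rw [hH]; fun_prop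
  have hH0 : deriv H a = 0 := by
    have d1 : HasDerivAt (fun z : ℂ => (z - a) ^ 2) 0 a := by
      have := ((hasDerivAt_id' a).sub_const a).fun_pow 2
      simpa using! this
    have d2 := ((d1.fun_mul hS'.differentiableAt.hasDerivAt).const_add 1).const_mul c
    have := d2.deriv
    rw [hH, this]
    simp
  have hev : (fun u => (u - a) ^ 2 * F u) =ᶠ[𝓝[≠] a] H := by
    rw [EventuallyEq, eventually_nhdsWithin_iff]
    filter_upwards [hT.eventually (ev_notMem L a ha), hT.eventually (ev_notMem L _ h2a),
      hT.eventually (ev_ne L)] with y k1 k2 k3 hy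
    have hy : y - a ≠ 0 := sub_ne_zero.mpr hy
    have e1 : a + (y - a) = y := by ring
    have e2 : 2 * a + (y - a) = y + a := by ring
    rw [e1] at k1
    rw [e2] at k2
    have h5 := hE2 _ hy
    rw [e1] at h5
    rw [hmain y k1 (k3 hy) k2, hH]
    simp only [hTS']
    linear_combination c * h5
  have hd := hev.nhdsNE_deriv
  refine Tendsto.congr' hd.symm ?_
  rw [← hH0]
  exact hHan.deriv.continuousAt.tendsto.mono_left nhdsWithin_le_nhds
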